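/- Let Γ be a profinite graph, i.e., a compact Hausdorff totally disconnected topological space with continuous maps d₀, d₁ : Γ → Γ satisfying dᵢ ∘ dⱼ = dⱼ for all i, j ∈ {0,1}. Define R₀ := {(x,y) | d₁(x) = d₀(y)}, R := R₀ ∪ R₀ᵒ ∪ Δ, and Σ := ⋃_{n≥1} Rⁿ. If Σ = Rⁿ for some n ≥ 1 (i.e., Γ has path components of diameter bounded by n), then Σ is a closed equivalence relation on Γ and every path component (Σ-equivalence class) of Γ is a closed subset of Γ. -/

import Mathlib

/-- Composition of binary relations on `X`, viewed as subsets of `X × X`: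
`(x, y) ∈ relComp R S` iff there is `z` with `(x, z) ∈ R` and `(z, y) ∈ S`. -/
def relComp {X : Type*} (R S : Set (X × X)) : Set (X × X) :=
  {p | ∃ z, (p.1, z) ∈ R ∧ (z, p.2) ∈ S}

/-- Iterated relational composition: `relPow R 1 = R` and
`relPow R (n + 1) = relComp (relPow R n) R` for `n ≥ 1`.
(The value at `0` is irrelevant; all statements assume `n ≥ 1`.) -/
def relPow {X : Type*} (R : Set (X × X)) : ℕ → Set (X × X)
  | 0 => R
  | 1 => R
  | n + 2 => relComp (relPow R (n + 1)) R

/-- Converse of a binary relation. -/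
def relConv {X : Type*} (R : Set (X × X)) : Set (X × X) := {p | (p.2, p.1) ∈ R}

/-- The diagonal relation `Δ` on `X`. -/
def relDiag (X : Type*) : Set (X × X) := {p | p.1 = p.2}

theorem IsClosed.relComp {X : Type*} [TopologicalSpace X] [CompactSpace X]
    {R S : Set (X × X)} (hR : IsClosed R) (hS : IsClosed S) : IsClosed (relComp R S) := by
  have h : IsClosed {q : (X × X) × X | (q.1.1, q.2) ∈ R ∧ (q.2, q.1.2) ∈ S} :=
    (hR.preimage (by fun_prop : Continuous fun q : (X × X) × X => (q.1.1, q.2))).inter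
      (hS.preimage (by fun_prop : Continuous fun q : (X × X) × X => (q.2, q.1.2)))
  convert isClosedMap_fst_of_compactSpace _ h using 1
  ext p
  simp [_root_.relComp]

theorem IsClosed.relPow {X : Type*} [TopologicalSpace X] [CompactSpace X]
    {R : Set (X × X)} (hR : IsClosed R) : ∀ n, IsClosed (relPow R n)
  | 0 => hR
  | 1 => hR
  | n + 2 => (IsClosed.relPow hR (n + 1)).relComp hR

theorem exists_mem_relPow_iff_transGen {X : Type*} (R : Set (X × X)) (x y : X) :
    (∃ n, 1 ≤ n ∧ (x, y) ∈ relPow R n) ↔ Relation.TransGen (fun a b => (a, b) ∈ R) x y := by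
  constructor
  · rintro ⟨n, hn, h⟩
    induction n, hn using Nat.le_induction generalizing y with
    | base => exact .single h
    | succ n hn ih =>
      obtain ⟨k, rfl⟩ := Nat.exists_eq_add_of_le' hn
      obtain ⟨z, hxz, hzy⟩ := h
      exact (ih z hxz).tail hzy
  · intro h
    induction h with
    | single h => exact ⟨1, le_rfl, h⟩
    | tail _ hzy ih =>
      obtain ⟨n, hn, h⟩ := ih
      obtain ⟨k, rfl⟩ := Nat.exists_eq_add_of_le' hn
      exact ⟨k + 2, by omega, _, h, hzy⟩

/-- for a profinite graph `Γ` (compact Hausdorff totally disconnected,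
with continuous `d₀, d₁`), if `Σ = Rⁿ` for some `n ≥ 1` then `Σ` is a closed
equivalence relation and every path component (`Σ`-class) is closed in `Γ`. -/
theorem stmt_6 {Γ : Type*} [TopologicalSpace Γ] [CompactSpace Γ] [T2Space Γ]
    [TotallyDisconnectedSpace Γ] (d₀ d₁ : Γ → Γ)
    (hc₀ : Continuous d₀) (hc₁ : Continuous d₁)
    (h00 : d₀ ∘ d₀ = d₀) (h01 : d₀ ∘ d₁ = d₁)
    (h10 : d₁ ∘ d₀ = d₀) (h11 : d₁ ∘ d₁ = d₁)
    (R₀ : Set (Γ × Γ)) (hR₀ : R₀ = {p | d₁ p.1 = d₀ p.2})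
    (R : Set (Γ × Γ)) (hR : R = R₀ ∪ relConv R₀ ∪ relDiag Γ)
    (Sig : Set (Γ × Γ)) (hSig : Sig = {p | ∃ n, 1 ≤ n ∧ p ∈ relPow R n})
    (n : ℕ) (hn : 1 ≤ n) (hdiam : Sig = relPow R n) :
    IsClosed Sig ∧ Equivalence (fun x y => (x, y) ∈ Sig) ∧
      ∀ x : Γ, IsClosed {y | (x, y) ∈ Sig} := by
  have hR₀c : IsClosed R₀ := by
    rw [hR₀]
    exact isClosed_eq (hc₁.comp continuous_fst) (hc₀.comp continuous_snd)
  have hRc : IsClosed R := by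
    rw [hR]
    exact (hR₀c.union (hR₀c.preimage continuous_swap)).union isClosed_diagonal
  have hSigc : IsClosed Sig := hdiam ▸ hRc.relPow n
  have hmem : ∀ x y, (x, y) ∈ Sig ↔ Relation.TransGen (fun a b => (a, b) ∈ R) x y := by
    intro x y
    rw [hSig]
    exact exists_mem_relPow_iff_transGen R x y
  have hsymm : Std.Symm (fun a b => (a, b) ∈ R) := by
    constructor
    intro a b h
    rw [hR] at h ⊢
    rcases h with (h | h) | h
    · exact .inl (.inr h)
    · exact .inl (.inl h)
    · exact .inr h.symm
  refine ⟨hSigc, ⟨fun x => ?_, fun {x y} h => ?_, fun {x y z} h h' => ?_⟩,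
    fun x => hSigc.preimage (Continuous.prodMk_right x)⟩
  · rw [hmem]
    exact .single (hR ▸ .inr rfl)
  · rw [hmem] at h ⊢
    exact Std.Symm.symm _ _ h
  · rw [hmem] at h h' ⊢
    exact h.trans h'
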